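/- Let m, n_1, n_2, p_1, p_2 be positive integers, A_1 a p_1 × (n_1+n_2) matrix of polynomials with integer coefficients, A_2 a p_2 × n_2 matrix of such polynomials, b_1 a vector of p_1 such polynomials, and b_2 a vector of p_2 such polynomials. For each positive integer t set R_1(t) = {x ∈ ℝ^{n_1+n_2} : x ≥ 0 and A_1(t)x = b_1(t)} and R_2(t) = {x ∈ ℝ^{n_2} : x ≥ 0 and A_2(t)x ≤ b_2(t)}, and assume both are bounded for every positive integer t. Let L_1(t) and L_2(t) be the sets of integer points of R_1(t) and R_2(t), and let L_3(t) = {x₂ ∈ L_2(t) : the number of x₃ ∈ ℤ^{n_1} with (x₂, x₃) ∈ L_1(t) is less than m}, where (x₂, x₃) denotes the concatenated vector with x₂ in the first n_2 coordinates. Then the size function g(t) = |L_3(t)| is eventually quasi-polynomial. -/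

import Mathlib

/-- Evaluation of an integer polynomial at a positive integer `t`. -/
def evalAt (p : Polynomial ℤ) (t : ℕ) : ℤ := p.eval (t : ℤ)

/-- A function `f` (on sufficiently large positive integers) is eventually
quasi-polynomial if there are a period `d > 0` and rational polynomials `R₀, …, R_{d-1}`
with `f t = R_{t mod d}(t)` for all sufficiently large `t`. -/
def IsEQP (f : ℕ → ℤ) : Prop :=
  ∃ d : ℕ, 0 < d ∧ ∃ R : ℕ → Polynomial ℚ, ∃ N : ℕ,
    ∀ t : ℕ, N ≤ t → (f t : ℚ) = (R (t % d)).eval (t : ℚ)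

/-- Lattice points of `R₁(t) = {x ≥ 0 : A₁(t) x = b₁(t)}`; coordinates are indexed by
`Fin n₂ ⊕ Fin n₁`, with the `Fin n₂` block the first `n₂` coordinates. -/
def latticeL1 {n1 n2 p1 : ℕ} (A1 : Matrix (Fin p1) (Fin n2 ⊕ Fin n1) (Polynomial ℤ))
    (b1 : Fin p1 → Polynomial ℤ) (t : ℕ) : Set ((Fin n2 ⊕ Fin n1) → ℤ) :=
  {x | (∀ j, 0 ≤ x j) ∧ ∀ i, ∑ j, evalAt (A1 i j) t * x j = evalAt (b1 i) t}

/-- Lattice points of `R₂(t) = {x ≥ 0 : A₂(t) x ≤ b₂(t)}`. -/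
def latticeL2 {n2 p2 : ℕ} (A2 : Matrix (Fin p2) (Fin n2) (Polynomial ℤ))
    (b2 : Fin p2 → Polynomial ℤ) (t : ℕ) : Set (Fin n2 → ℤ) :=
  {x | (∀ j, 0 ≤ x j) ∧ ∀ i, ∑ j, evalAt (A2 i j) t * x j ≤ evalAt (b2 i) t}

/-- `L₃(t)`: the points of `L₂(t)` which are the projection of fewer than `m` points
of `L₁(t)`. -/
noncomputable def latticeL3 {n1 n2 p1 p2 : ℕ} (m : ℕ)
    (A1 : Matrix (Fin p1) (Fin n2 ⊕ Fin n1) (Polynomial ℤ)) (b1 : Fin p1 → Polynomial ℤ)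
    (A2 : Matrix (Fin p2) (Fin n2) (Polynomial ℤ)) (b2 : Fin p2 → Polynomial ℤ)
    (t : ℕ) : Set (Fin n2 → ℤ) :=
  {x2 ∈ latticeL2 A2 b2 t |
    {x3 : Fin n1 → ℤ | Sum.elim x2 x3 ∈ latticeL1 A1 b1 t}.ncard < m}


/-- Eventually quasi-polynomial, for rational valued functions. -/
def EQ (f : ℕ → ℚ) : Prop :=
  ∃ d : ℕ, 0 < d ∧ ∃ R : ℕ → Polynomial ℚ, ∃ N : ℕ,
    ∀ t : ℕ, N ≤ t → f t = (R (t % d)).eval (t : ℚ)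

theorem EQ.congr {f g : ℕ → ℚ} (hf : EQ f) (N : ℕ) (h : ∀ t, N ≤ t → g t = f t) : EQ g := by
  obtain ⟨d, hd, R, M, hR⟩ := hf
  refine ⟨d, hd, R, max M N, fun t ht => ?_⟩
  rw [h t (le_trans (le_max_right _ _) ht), hR t (le_trans (le_max_left _ _) ht)]

theorem EQ.zero : EQ (fun _ => 0) := ⟨1, one_pos, fun _ => 0, 0, fun t _ => by simp⟩

theorem EQ.add {f g : ℕ → ℚ} (hf : EQ f) (hg : EQ g) : EQ (fun t => f t + g t) := by
  obtain ⟨d, hd, R, M, hR⟩ := hf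
  obtain ⟨e, he, S, N, hS⟩ := hg
  refine ⟨d * e, by positivity, fun i => R (i % d) + S (i % e), max M N, fun t ht => ?_⟩
  simp only []
  rw [hR t (le_trans (le_max_left _ _) ht), hS t (le_trans (le_max_right _ _) ht)]
  simp [Nat.mod_mul_right_mod, Nat.mod_mul_left_mod]

theorem EQ.neg {f : ℕ → ℚ} (hf : EQ f) : EQ (fun t => - f t) := by
  obtain ⟨d, hd, R, M, hR⟩ := hf
  refine ⟨d, by positivity, fun i => - R i, M, fun t ht => ?_⟩
  simp only []
  rw [hR t ht]; simp

theorem EQ.sub {f g : ℕ → ℚ} (hf : EQ f) (hg : EQ g) : EQ (fun t => f t - g t) :=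
  (hf.add hg.neg).congr 0 (fun t _ => by ring)

theorem EQ.sum {ι : Type*} (s : Finset ι) {f : ι → ℕ → ℚ} (hf : ∀ i ∈ s, EQ (f i)) :
    EQ (fun t => ∑ i ∈ s, f i t) := by
  classical
  induction s using Finset.induction_on with
  | empty => simpa using EQ.zero
  | insert a s ha ih =>
    simp only [Finset.sum_insert ha]
    exact (hf a (by simp)).add (ih fun i hi => hf i (by simp [hi]))

theorem EQ.shiftFwd {f : ℕ → ℚ} (hf : EQ f) (a : ℕ) : EQ (fun t => f (t + a)) := by
  obtain ⟨d, hd, R, M, hR⟩ := hf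
  refine ⟨d, hd, fun i => (R ((i + a) % d)).comp (Polynomial.X + Polynomial.C (a : ℚ)), M,
    fun t ht => ?_⟩
  simp only []
  rw [hR (t + a) (by omega)]
  simp

theorem EQ.shiftBack {f : ℕ → ℚ} (a : ℕ) (hf : EQ (fun t => f (t + a))) : EQ f := by
  obtain ⟨d, hd, R, M, hR⟩ := hf
  refine ⟨d, hd, fun i => (R ((i + (d - a % d)) % d)).comp (Polynomial.X - Polynomial.C (a : ℚ)),
    M + a, fun t ht => ?_⟩
  obtain ⟨s, rfl⟩ : ∃ s, t = s + a := ⟨t - a, by omega⟩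
  have := hR s (by omega)
  simp only [] at this
  rw [this]
  have h : (s + a) % d + (d - a % d) ≡ s [MOD d] := by
    have h1 : (s + a) % d + (d - a % d) ≡ (s + a % d) + (d - a % d) [MOD d] :=
      Nat.ModEq.add_right _ ((Nat.mod_modEq _ _).trans
        (Nat.ModEq.add_left _ (Nat.mod_modEq _ _).symm))
    have h2 : (s + a % d) + (d - a % d) = s + d := by
      have := Nat.mod_lt a hd; omega
    rw [h2] at h1
    exact h1.trans (by simp [Nat.ModEq])
  have h' : ((s + a) % d + (d - a % d)) % d = s % d := h
  simp only [h']
  simp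

theorem exists_antidiff_one (p : Polynomial ℚ) :
    ∃ q : Polynomial ℚ, ∀ x : ℚ, q.eval (x + 1) = q.eval x + p.eval x := by
  induction p using Polynomial.induction_on' with
  | add p q hp hq =>
    obtain ⟨a, ha⟩ := hp
    obtain ⟨b, hb⟩ := hq
    exact ⟨a + b, fun x => by simp [ha, hb]; ring⟩
  | monomial n c =>
    refine ⟨Polynomial.C (c / (n + 1)) * Polynomial.bernoulli (n + 1), fun x => ?_⟩
    have := congrArg (Polynomial.eval x) (Polynomial.bernoulli_comp_one_add_X (n + 1))
    simp at this
    have h1 : (n + 1 : ℚ) ≠ 0 := by positivity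
    simp [add_comm x 1, this]
    field_simp

theorem exists_antidiff (p : Polynomial ℚ) (D : ℕ) (hD : 0 < D) :
    ∃ q : Polynomial ℚ, ∀ x : ℚ, q.eval (x + D) = q.eval x + p.eval x := by
  obtain ⟨q, hq⟩ := exists_antidiff_one (p.comp (Polynomial.C (D : ℚ) * Polynomial.X))
  have h1 : (D : ℚ) ≠ 0 := by positivity
  refine ⟨q.comp (Polynomial.C (1 / D : ℚ) * Polynomial.X), fun x => ?_⟩
  have := hq (1 / D * x)
  simp only [Polynomial.eval_comp, Polynomial.eval_mul, Polynomial.eval_C, Polynomial.eval_X]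
    at this ⊢
  rw [show 1 / (D : ℚ) * (x + D) = 1 / D * x + 1 by field_simp, this,
    show (D : ℚ) * (1 / D * x) = x by field_simp]

theorem EQ.antidiff {f g : ℕ → ℚ} (hf : EQ f) (w : ℕ) (hw : 0 < w)
    (h : ∀ t, g (t + w) = g t + f t) : EQ g := by
  obtain ⟨d, hd, R, N, hR⟩ := hf
  have hD : 0 < d * w := by positivity
  let P : ℕ → Polynomial ℚ := fun r => ∑ i ∈ Finset.range d,
    (R ((r + i * w) % d)).comp (Polynomial.X + Polynomial.C ((i * w : ℕ) : ℚ))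
  have hstep : ∀ n t, g (t + n * w) = g t + ∑ i ∈ Finset.range n, f (t + i * w) := by
    intro n t
    induction n with
    | zero => simp
    | succ n ih =>
      rw [Finset.sum_range_succ, ← add_assoc, ← ih, ← h]
      congr 1; ring
  have hP : ∀ t, N ≤ t → g (t + d * w) = g t + (P (t % (d * w))).eval (t : ℚ) := by
    intro t ht
    rw [hstep]
    congr 1
    simp only [P, Polynomial.eval_finsetSum]
    refine Finset.sum_congr rfl fun i _ => ?_
    rw [hR _ (by omega)]
    have : (t % (d * w) + i * w) % d = (t + i * w) % d := by
      rw [Nat.add_mod, Nat.mod_mul_right_mod, ← Nat.add_mod]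
    rw [this]
    simp
  choose Q hQ using fun r => exists_antidiff (P r) (d * w) hD
  refine ⟨d * w, hD, fun r => Q r + Polynomial.C
    (g (r + d * w * N) - (Q r).eval ((r + d * w * N : ℕ) : ℚ)), d * w * N + d * w, fun t ht => ?_⟩
  have key : ∀ r, r < d * w → ∀ n, g (r + d * w * N + n * (d * w)) =
      (Q r).eval ((r + d * w * N + n * (d * w) : ℕ) : ℚ) +
      (g (r + d * w * N) - (Q r).eval ((r + d * w * N : ℕ) : ℚ)) := by
    intro r hr n
    induction n with
    | zero => simp
    | succ n ih =>
      have e : r + d * w * N + (n + 1) * (d * w) = (r + d * w * N + n * (d * w)) + d * w := by ring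
      have hN : N ≤ d * w * N := Nat.le_mul_of_pos_left _ hD
      have hm : (r + d * w * N + n * (d * w)) % (d * w) = r := by
        rw [Nat.add_mul_mod_self_right, Nat.add_mul_mod_self_left, Nat.mod_eq_of_lt hr]
      rw [e, hP _ (by omega), hm, ih, Nat.cast_add _ (d * w), hQ]
      ring
  have h1 : t = t % (d * w) + d * w * N + (t / (d * w) - N) * (d * w) := by
    have h2 := Nat.mod_add_div t (d * w)
    have h3 : N ≤ t / (d * w) := by
      rw [Nat.le_div_iff_mul_le hD]; rw [mul_comm]; omega
    obtain ⟨k, hk⟩ := Nat.exists_eq_add_of_le h3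
    rw [hk] at h2 ⊢
    rw [Nat.add_sub_cancel_left]
    linarith
  have h4 := key (t % (d * w)) (Nat.mod_lt _ hD) (t / (d * w) - N)
  rw [← h1] at h4
  rw [h4]
  simp


theorem dickson {α : Type*} [PartialOrder α] [WellQuasiOrderedLE α] (U : Set α) :
    ∃ B : Set α, B.Finite ∧ B ⊆ U ∧ ∀ u ∈ U, ∃ b ∈ B, b ≤ u := by
  refine ⟨{x | Minimal (· ∈ U) x}, ?_, fun x hx => hx.prop, fun u hu => ?_⟩
  · exact WellQuasiOrderedLE.finite_of_isAntichain (setOfPred_minimal_antichain _)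
  · obtain ⟨b, hb, hm⟩ := exists_minimal_le_of_wellFoundedLT (· ∈ U) u hu
    exact ⟨b, hm, hb⟩

theorem fiber_slice {r : ℕ} (D : Set (Fin (r + 1) → ℕ)) (w : Fin (r + 1) → ℕ) (s t : ℕ) :
    {k | k ∈ D ∧ k 0 = s ∧ ∑ i, w i * k i = t + w 0 * s} =
      Fin.cons s '' {k' : Fin r → ℕ | Fin.cons s k' ∈ {k | k ∈ D} ∧ ∑ i, w i.succ * k' i = t} := by
  ext k
  constructor
  · rintro ⟨h1, h2, h3⟩
    refine ⟨Fin.tail k, ⟨?_, ?_⟩, ?_⟩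
    · rw [← h2]; simpa using h1
    · rw [Fin.sum_univ_succ, h2] at h3
      simp only [Fin.tail]; omega
    · rw [← h2]; simp
  · rintro ⟨k', ⟨h1, h2⟩, rfl⟩
    refine ⟨h1, by simp, ?_⟩
    rw [Fin.sum_univ_succ]
    simp [h2, add_comm]

set_option maxHeartbeats 4000000 in
theorem lowerSet_count (r : ℕ) (D : Set (Fin r → ℕ)) (hD : IsLowerSet D) (w : Fin r → ℕ)
    (hfin : ∀ t, {k | k ∈ D ∧ ∑ i, w i * k i = t}.Finite) :
    EQ (fun t => ({k | k ∈ D ∧ ∑ i, w i * k i = t}.ncard : ℚ)) := by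
  induction r with
  | zero =>
    refine EQ.zero.congr 1 fun t ht => ?_
    have : {k : Fin 0 → ℕ | k ∈ D ∧ ∑ i, w i * k i = t} = ∅ := by
      ext k; simp; omega
    rw [this]; simp
  | succ r ih =>
    -- slices
    have hslice : ∀ s, EQ (fun t => ({k | k ∈ D ∧ k 0 = s ∧ ∑ i, w i * k i = t}.ncard : ℚ)) := by
      intro s
      apply EQ.shiftBack (w 0 * s)
      simp only [fiber_slice]
      simp only [Set.ncard_image_of_injective _ (Fin.cons_right_injective (α := fun _ => ℕ) s)]
      refine ih {k' | Fin.cons s k' ∈ {k | k ∈ D}} ?_ (fun i => w i.succ) ?_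
      · intro a b hba ha
        exact hD (by rw [Fin.cons_le_cons]; exact ⟨le_rfl, hba⟩) ha
      · intro t
        have h1 : ({k | k ∈ D ∧ k 0 = s ∧ ∑ i, w i * k i = t + w 0 * s}).Finite :=
          (hfin (t + w 0 * s)).subset (fun k hk => ⟨hk.1, hk.2.2⟩)
        rw [fiber_slice] at h1
        exact h1.of_finite_image (Fin.cons_right_injective (α := fun _ => ℕ) s).injOn
    -- stabilisation
    obtain ⟨s0, hs0⟩ : ∃ s0, ∀ s, s0 ≤ s → ∀ k' : Fin r → ℕ,
        (Fin.cons s0 k' : Fin (r+1) → ℕ) ∈ D → (Fin.cons s k' : Fin (r+1) → ℕ) ∈ D := by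
      obtain ⟨B, hB, hBU, hBm⟩ := dickson Dᶜ
      obtain ⟨s0, hs0⟩ := (hB.image (fun k => k 0)).bddAbove
      refine ⟨s0, fun s hs k' hk => ?_⟩
      by_contra hn
      obtain ⟨b, hb, hle⟩ := hBm _ hn
      refine hBU hb (hD (fun i => ?_) hk)
      refine Fin.cases ?_ (fun i => ?_) i
      · simpa using hs0 ⟨b, hb, rfl⟩
      · simpa using hle i.succ
    have hstab : ∀ k ∈ D, s0 ≤ k 0 → ∀ n, s0 ≤ n → Function.update k 0 n ∈ D := by
      intro k hk h0 n hn
      have e : Function.update k 0 n = Fin.cons n (Fin.tail k) := by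
        rw [← Fin.cons_self_tail k, Fin.update_cons_zero, Fin.tail_cons]
      rw [e]
      apply hs0 n hn
      refine hD (fun i => ?_) hk
      refine Fin.cases ?_ (fun i => ?_) i
      · simpa using h0
      · simp [Fin.tail]
    let G : ℕ → Set (Fin (r + 1) → ℕ) := fun t => {k | k ∈ D ∧ s0 ≤ k 0 ∧ ∑ i, w i * k i = t}
    have hGfin : ∀ t, (G t).Finite := fun t => (hfin t).subset (fun k hk => ⟨hk.1, hk.2.2⟩)
    have hupd : ∀ (k : Fin (r + 1) → ℕ) n, ∑ i, w i * Function.update k 0 n i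
        = w 0 * n + ∑ i : Fin r, w i.succ * k i.succ := by
      intro k n
      rw [Fin.sum_univ_succ]
      simp
    have hG : EQ (fun t => ((G t).ncard : ℚ)) := by
      rcases Nat.eq_zero_or_pos (w 0) with h0 | h0
      · refine EQ.zero.congr 0 fun t _ => ?_
        have : G t = ∅ := by
          by_contra hne
          obtain ⟨k, hk⟩ := Set.nonempty_iff_ne_empty.2 hne
          have hinf : (Set.range (fun n => Function.update k 0 (s0 + n))).Infinite := by
            apply Set.infinite_range_of_injective
            intro a b hab
            have := congrFun hab 0
            simpa using this
          refine hinf ((hGfin t).subset ?_)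
          rintro _ ⟨n, rfl⟩
          refine ⟨hstab k hk.1 hk.2.1 _ (by omega), by simp, ?_⟩
          rw [hupd, ← hk.2.2, Fin.sum_univ_succ, h0]; simp
        rw [this]; simp
      · refine EQ.antidiff ((hslice s0).shiftFwd (w 0)) (w 0) h0 fun t => ?_
        have e1 : G (t + w 0) = {k | k ∈ D ∧ k 0 = s0 ∧ ∑ i, w i * k i = t + w 0} ∪
            (fun k => Function.update k 0 (k 0 + 1)) '' G t := by
          ext k
          constructor
          · rintro ⟨h1, h2, h3⟩
            rcases h2.eq_or_lt with h2 | h2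
            · exact Or.inl ⟨h1, h2.symm, h3⟩
            · refine Or.inr ⟨Function.update k 0 (k 0 - 1), ⟨hstab k h1 h2.le _ (by omega),
                by simp; omega, ?_⟩, ?_⟩
              · rw [hupd]
                rw [Fin.sum_univ_succ] at h3
                obtain ⟨n, hn⟩ : ∃ n, k 0 = n + 1 := ⟨k 0 - 1, by omega⟩
                rw [hn] at h3 ⊢
                rw [mul_add] at h3
                simp; omega
              · have : k 0 - 1 + 1 = k 0 := by omega
                simp [this]
          · rintro (⟨h1, h2, h3⟩ | ⟨k, ⟨h1, h2, h3⟩, rfl⟩)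
            · exact ⟨h1, h2.ge, h3⟩
            · refine ⟨hstab k h1 h2 _ (by omega), by simp; omega, ?_⟩
              simp only []
              rw [hupd]
              rw [Fin.sum_univ_succ] at h3
              rw [mul_add]; omega
        have hinj : Function.Injective
            (fun k : Fin (r+1) → ℕ => Function.update k 0 (k 0 + 1)) := by
          intro a b hab
          ext i
          refine Fin.cases ?_ (fun i => ?_) i
          · simpa using congrFun hab 0
          · simpa using congrFun hab i.succ
        rw [e1, Set.ncard_union_eq ?_ ?_ ?_, Set.ncard_image_of_injective _ hinj]
        · push_cast; ring
        · rw [Set.disjoint_left]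
          rintro _ ⟨_, h2, _⟩ ⟨k, ⟨_, h3, _⟩, rfl⟩
          simp at h2; omega
        · exact (hfin (t + w 0)).subset (fun k hk => ⟨hk.1, hk.2.2⟩)
        · exact (hGfin t).image _
    refine ((EQ.sum (Finset.range s0) fun s _ => hslice s).add hG).congr 0 fun t _ => ?_
    have e2 : {k | k ∈ D ∧ ∑ i, w i * k i = t} =
        (⋃ s ∈ Finset.range s0, {k | k ∈ D ∧ k 0 = s ∧ ∑ i, w i * k i = t}) ∪ G t := by
      ext k
      simp only [Set.mem_ofPred_eq, Set.mem_union, Set.mem_iUnion, Finset.mem_range, G]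
      constructor
      · rintro ⟨h1, h2⟩
        rcases lt_or_ge (k 0) s0 with h | h
        · exact Or.inl ⟨k 0, h, h1, rfl, h2⟩
        · exact Or.inr ⟨h1, h, h2⟩
      · rintro (⟨_, _, h1, _, h2⟩ | ⟨h1, _, h2⟩) <;> exact ⟨h1, h2⟩
    have hf2 : ∀ s, {k | k ∈ D ∧ k 0 = s ∧ ∑ i, w i * k i = t}.Finite :=
      fun s => (hfin t).subset (fun k hk => ⟨hk.1, hk.2.2⟩)
    rw [e2, Set.ncard_union_eq _ _ (hGfin t)]
    · have : (⋃ s ∈ Finset.range s0, {k | k ∈ D ∧ k 0 = s ∧ ∑ i, w i * k i = t}).ncard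
          = ∑ s ∈ Finset.range s0, {k | k ∈ D ∧ k 0 = s ∧ ∑ i, w i * k i = t}.ncard := by
        generalize s0 = n
        induction n with
        | zero => simp
        | succ n ihn =>
          rw [Finset.sum_range_succ, ← ihn, Finset.range_add_one, Finset.set_biUnion_insert,
            Set.union_comm, Set.ncard_union_eq ?_ ?_ ?_]
          · rw [Set.disjoint_left]
            intro k hk hk2
            simp only [Set.mem_ofPred_eq, Set.mem_iUnion, Finset.mem_range] at hk hk2
            obtain ⟨i, hi, _, hi2, _⟩ := hk
            omega
          · exact (Finset.range n).finite_toSet.biUnion fun s _ => hf2 s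
          · exact hf2 n
      rw [this]; push_cast; ring
    · rw [Set.disjoint_left]
      intro k hk hk2
      simp only [Set.mem_ofPred_eq, Set.mem_iUnion, Finset.mem_range, G] at hk hk2
      obtain ⟨i, hi, _, hi2, _⟩ := hk
      omega
    · exact (Finset.range s0).finite_toSet.biUnion fun s _ => hf2 s


/-- Finite unions of translates of one finitely generated submonoid. -/
def Modular {V : Type*} [AddCommMonoid V] (T : Set V) : Prop :=
  ∃ (F : Set V) (M : AddSubmonoid V), F.Finite ∧ M.FG ∧ T = {v | ∃ a ∈ F, ∃ x ∈ M, v = a + x}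

theorem Modular.inter {V : Type*} [AddCommMonoid V] [IsCancelAdd V] {S T : Set V}
    (hS : Modular S) (hT : Modular T) : Modular (S ∩ T) := by
  obtain ⟨F, M, hF, hM, rfl⟩ := hS
  obtain ⟨G, N, hG, hN, rfl⟩ := hT
  obtain ⟨r, f, rfl⟩ := AddSubmonoid.fg_iff_exists_fin_addMonoidHom.1 hM
  obtain ⟨s, g, rfl⟩ := AddSubmonoid.fg_iff_exists_fin_addMonoidHom.1 hN
  let f' : (Fin r → ℕ) × (Fin s → ℕ) →+ V := f.comp (AddMonoidHom.fst _ _)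
  let g' : (Fin r → ℕ) × (Fin s → ℕ) →+ V := g.comp (AddMonoidHom.snd _ _)
  have hE : (f'.eqLocusM g').FG := AddSubmonoid.fg_eqLocusM f' g'
  choose B hB hBU hBm using fun a b : V => dickson {p | a + f' p = b + g' p}
  refine ⟨⋃ a ∈ F, ⋃ b ∈ G, (fun p => a + f' p) '' B a b, (f'.eqLocusM g').map f',
    hF.biUnion fun a _ => hG.biUnion fun b _ => (hB a b).image _, hE.map _, ?_⟩
  ext v
  constructor
  · rintro ⟨⟨a, ha, _, ⟨k, rfl⟩, rfl⟩, ⟨b, hb, _, ⟨l, rfl⟩, h⟩⟩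
    obtain ⟨p, hp, hle⟩ := hBm a b (k, l) h
    obtain ⟨q, hq⟩ := exists_add_of_le hle
    refine ⟨a + f' p, ?_, f' q, ?_, ?_⟩
    · simp only [Set.mem_iUnion]
      exact ⟨a, ha, b, hb, p, hp, rfl⟩
    · refine ⟨q, ?_, rfl⟩
      have h1 : a + f' p = b + g' p := hBU a b hp
      have h2 : a + f' (k, l) = b + g' (k, l) := h
      rw [hq, map_add, map_add, ← add_assoc, ← add_assoc, h1] at h2
      exact add_left_cancel h2
    · have : f k = f' (k, l) := rfl
      rw [this, hq, map_add, add_assoc]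
  · rintro ⟨c, hc, _, ⟨q, hq, rfl⟩, rfl⟩
    simp only [Set.mem_iUnion] at hc
    obtain ⟨a, ha, b, hb, p, hp, rfl⟩ := hc
    have h1 : a + f' p = b + g' p := hBU a b hp
    have h2 : f' q = g' q := hq
    refine ⟨⟨a, ha, f' (p + q), ⟨(p + q).1, rfl⟩, ?_⟩, ⟨b, hb, g' (p + q), ⟨(p + q).2, rfl⟩, ?_⟩⟩
    · simp [map_add, add_assoc]
    · simp only [map_add, ← add_assoc]
      rw [h1, h2]

theorem hom_eq_sum {r : ℕ} (h : (Fin r → ℕ) →+ ℕ) (k : Fin r → ℕ) :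
    h k = ∑ i, h (Pi.single i 1) * k i := by
  conv_lhs => rw [← Finset.univ_sum_single k]
  rw [map_sum]
  refine Finset.sum_congr rfl fun i _ => ?_
  have : (Pi.single i (k i) : Fin r → ℕ) = k i • Pi.single i 1 := by
    rw [← Pi.single_smul]; simp
  rw [this, map_nsmul, smul_eq_mul, mul_comm]

theorem coset_diff_count {V : Type*} [AddCommMonoid V] (τ : V →+ ℕ) (a : V)
    (M : AddSubmonoid V) (hM : M.FG) (U : Set V) (hU : ∀ u ∈ U, ∀ x ∈ M, u + x ∈ U)
    (hfin : ∀ t, {v | (∃ x ∈ M, v = a + x) ∧ v ∉ U ∧ τ v = t}.Finite) (hc : IsCancelAdd V) :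
    EQ (fun t => ({v | (∃ x ∈ M, v = a + x) ∧ v ∉ U ∧ τ v = t}.ncard : ℚ)) := by
  obtain ⟨r, f, rfl⟩ := AddSubmonoid.fg_iff_exists_fin_addMonoidHom.1 hM
  let D : Set (Fin r → ℕ) :=
    {k | a + f k ∉ U ∧ ∀ k', toLex k' < toLex k → f k' ≠ f k}
  have hD : IsLowerSet D := by
    intro l k hkl hl
    obtain ⟨u, rfl⟩ := exists_add_of_le hkl
    refine ⟨fun hk => hl.1 ?_, fun k' hk' he => hl.2 (k' + u) ?_ ?_⟩
    · rw [map_add, ← add_assoc]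
      exact hU _ hk _ ⟨u, rfl⟩
    · rw [toLex_add, toLex_add]
      exact add_lt_add_left hk' _
    · rw [map_add, map_add, he]
  have hinj : Set.InjOn (fun k => a + f k) D := by
    intro k hk l hl h
    have h' : f k = f l := add_left_cancel h
    rcases lt_trichotomy (toLex k) (toLex l) with h1 | h1 | h1
    · exact absurd h' (hl.2 k h1)
    · exact toLex.injective h1
    · exact absurd h'.symm (hk.2 l h1)
  have himg : ∀ t, {v | (∃ x ∈ AddMonoidHom.mrange f, v = a + x) ∧ v ∉ U ∧ τ v = t + τ a} =
      (fun k => a + f k) '' {k | k ∈ D ∧ ∑ i, (τ.comp f) (Pi.single i 1) * k i = t} := by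
    intro t
    ext v
    constructor
    · rintro ⟨⟨_, ⟨k0, rfl⟩, rfl⟩, h2, h3⟩
      let Q : Set (Lex (Fin r → ℕ)) := {k | f (ofLex k) = f k0}
      obtain ⟨k, hk, hmin⟩ := WellFounded.has_min
        (wellFounded_lt (α := Lex (Fin r → ℕ))) Q ⟨toLex k0, rfl⟩
      have hk' : f (ofLex k) = f k0 := hk
      refine ⟨ofLex k, ⟨⟨?_, ?_⟩, ?_⟩, ?_⟩
      · rw [hk']; exact h2
      · intro k' hlt he
        exact hmin (toLex k') (he.trans hk') hlt
      · rw [← hom_eq_sum]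
        simp only [AddMonoidHom.comp_apply, hk']
        rw [map_add] at h3; omega
      · simp only [hk']
    · rintro ⟨k, ⟨h1, h2⟩, rfl⟩
      refine ⟨⟨_, ⟨k, rfl⟩, rfl⟩, h1.1, ?_⟩
      rw [← hom_eq_sum] at h2
      rw [map_add, ← h2, add_comm]; rfl
  apply EQ.shiftBack (τ a)
  have hfin' : ∀ t, {k | k ∈ D ∧ ∑ i, (τ.comp f) (Pi.single i 1) * k i = t}.Finite := by
    intro t
    have := hfin (t + τ a)
    rw [himg t] at this
    exact this.of_finite_image (hinj.mono fun k hk => hk.1)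
  refine (lowerSet_count r D hD _ hfin').congr 0 fun t _ => ?_
  rw [himg t, Set.ncard_image_of_injOn (hinj.mono fun k hk => hk.1)]

theorem Modular.count {V : Type*} [AddCommMonoid V] [hc : IsCancelAdd V] (τ : V →+ ℕ) {T : Set V}
    (hT : Modular T) (hfin : ∀ t, {v | v ∈ T ∧ τ v = t}.Finite) :
    EQ (fun t => ({v | v ∈ T ∧ τ v = t}.ncard : ℚ)) := by
  obtain ⟨F, M, hF, hM, rfl⟩ := hT
  induction F, hF using Set.Finite.induction_on with
  | empty => simpa using EQ.zero
  | @insert a F ha hF ih =>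
    let U : Set V := {v | ∃ a ∈ F, ∃ x ∈ M, v = a + x}
    have hUfin : ∀ t, {v | v ∈ U ∧ τ v = t}.Finite := by
      intro t
      refine (hfin t).subset ?_
      rintro v ⟨⟨b, hb, x, hx, rfl⟩, h⟩
      exact ⟨⟨b, Or.inr hb, x, hx, rfl⟩, h⟩
    have hAfin : ∀ t, {v | (∃ x ∈ M, v = a + x) ∧ v ∉ U ∧ τ v = t}.Finite := by
      intro t
      refine (hfin t).subset ?_
      rintro v ⟨⟨x, hx, rfl⟩, _, h⟩
      exact ⟨⟨a, Or.inl rfl, x, hx, rfl⟩, h⟩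
    have h1 := ih hUfin
    have h2 := coset_diff_count τ a M hM U (by
      rintro _ ⟨b, hb, x, hx, rfl⟩ y hy
      exact ⟨b, hb, x + y, M.add_mem hx hy, by rw [add_assoc]⟩) hAfin hc
    refine (h1.add h2).congr 0 fun t _ => ?_
    have e : {v | v ∈ {v | ∃ b ∈ insert a F, ∃ x ∈ M, v = b + x} ∧ τ v = t} =
        {v | v ∈ U ∧ τ v = t} ∪ {v | (∃ x ∈ M, v = a + x) ∧ v ∉ U ∧ τ v = t} := by
      ext v
      constructor
      · rintro ⟨⟨b, hb, x, hx, rfl⟩, h⟩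
        by_cases hu : b + x ∈ U
        · exact Or.inl ⟨hu, h⟩
        · rcases hb with rfl | hb
          · exact Or.inr ⟨⟨x, hx, rfl⟩, hu, h⟩
          · exact absurd ⟨b, hb, x, hx, rfl⟩ hu
      · rintro (⟨⟨b, hb, x, hx, rfl⟩, h⟩ | ⟨⟨x, hx, rfl⟩, _, h⟩)
        · exact ⟨⟨b, Or.inr hb, x, hx, rfl⟩, h⟩
        · exact ⟨⟨a, Or.inl rfl, x, hx, rfl⟩, h⟩
    rw [e, Set.ncard_union_eq ?_ (hUfin t) (hAfin t)]
    · push_cast; rfl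
    · rw [Set.disjoint_left]
      rintro v ⟨h, _⟩ ⟨_, h', _⟩
      exact h' h

theorem union_count {V : Type*} [AddCommMonoid V] [hc : IsCancelAdd V] (τ : V →+ ℕ) (n : ℕ)
    (T : Fin n → Set V) (hT : ∀ i, Modular (T i))
    (hfin : ∀ i t, {v | v ∈ T i ∧ τ v = t}.Finite) :
    EQ (fun t => ({v | (∃ i, v ∈ T i) ∧ τ v = t}.ncard : ℚ)) := by
  induction n with
  | zero => simpa using EQ.zero
  | succ n ih =>
    have h1 := (hT 0).count τ (hfin 0)
    have h2 := ih (fun i => T i.succ) (fun i => hT _) (fun i => hfin _)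
    have h3 := ih (fun i => T 0 ∩ T i.succ) (fun i => (hT 0).inter (hT _))
      (fun i t => (hfin 0 t).subset fun v hv => ⟨hv.1.1, hv.2⟩)
    refine ((h1.add h2).sub h3).congr 0 fun t _ => ?_
    have e1 : {v | (∃ i, v ∈ T i) ∧ τ v = t} = {v | v ∈ T 0 ∧ τ v = t} ∪
        {v | (∃ i : Fin n, v ∈ T i.succ) ∧ τ v = t} := by
      ext v
      simp only [Set.mem_ofPred_eq, Set.mem_union, Fin.exists_fin_succ]
      tauto
    have e2 : {v | (∃ i : Fin n, v ∈ T 0 ∩ T i.succ) ∧ τ v = t} = {v | v ∈ T 0 ∧ τ v = t} ∩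
        {v | (∃ i : Fin n, v ∈ T i.succ) ∧ τ v = t} := by
      ext v
      simp only [Set.mem_ofPred_eq, Set.mem_inter_iff, exists_and_left]
      tauto
    have hf2 : {v | (∃ i : Fin n, v ∈ T i.succ) ∧ τ v = t}.Finite := by
      have : {v | (∃ i : Fin n, v ∈ T i.succ) ∧ τ v = t} =
          ⋃ i : Fin n, {v | v ∈ T i.succ ∧ τ v = t} := by
        ext v; simp
      rw [this]
      exact Set.finite_iUnion fun i => hfin _ t
    rw [e1, e2]
    have := Set.ncard_union_add_ncard_inter {v | v ∈ T 0 ∧ τ v = t}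
        {v | (∃ i : Fin n, v ∈ T i.succ) ∧ τ v = t} (hfin 0 t) hf2
    have h' := congrArg (Nat.cast : ℕ → ℚ) this
    push_cast at h'
    linarith

theorem IsSemilinearSet.count {V : Type*} [AddCommMonoid V] [hc : IsCancelAdd V] (τ : V →+ ℕ)
    {S : Set V} (hS : IsSemilinearSet S) (hfin : ∀ t, {v | v ∈ S ∧ τ v = t}.Finite) :
    EQ (fun t => ({v | v ∈ S ∧ τ v = t}.ncard : ℚ)) := by
  obtain ⟨C, hC, hlin, rfl⟩ := hS
  obtain ⟨n, f, hf⟩ := hC.fin_embedding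
  have hmem : ∀ v, (v ∈ ⋃₀ C) ↔ ∃ i, v ∈ f i := by
    intro v
    rw [← hf]; simp
  refine (union_count τ n f (fun i => ?_) (fun i t => ?_)).congr 0 fun t _ => ?_
  · obtain ⟨a, P, hP, h⟩ := isLinearSet_iff_exists_fg_eq_vadd.1
      (hlin (f i) (hf ▸ Set.mem_range_self i))
    refine ⟨{a}, P, Set.finite_singleton a, hP, ?_⟩
    rw [h]
    ext v
    simp [Set.mem_vadd_set, eq_comm]
  · exact (hfin t).subset fun v hv => ⟨(hmem v).2 ⟨i, hv.1⟩, hv.2⟩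
  · simp only [hmem]


theorem halfspace_semilinear {κ : Type*} [Fintype κ] (c : ℤ) (a : κ → ℤ) :
    IsSemilinearSet {v : κ → ℕ | c + ∑ i, a i * (v i : ℤ) ≤ 0} := by
  let f : (κ → ℕ) × ℕ →+ ℤ :=
    { toFun := fun p => ∑ i, a i * (p.1 i : ℤ) + p.2
      map_zero' := by simp
      map_add' := fun p q => by
        simp only [Prod.fst_add, Prod.snd_add, Pi.add_apply, Nat.cast_add, mul_add,
          Finset.sum_add_distrib]
        ring }
  have h := (isSemilinearSet_setOfPred_eq c 0 f (0 : (κ → ℕ) × ℕ →+ ℤ)).image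
    (AddMonoidHom.fst (κ → ℕ) ℕ)
  convert! h using 1
  ext v
  simp only [Set.mem_ofPred_eq, Set.mem_image]
  constructor
  · intro hv
    refine ⟨(v, (-(c + ∑ i, a i * (v i : ℤ))).toNat), ?_, rfl⟩
    simp only [f, AddMonoidHom.coe_mk, ZeroHom.coe_mk, AddMonoidHom.zero_apply]
    omega
  · rintro ⟨⟨v', s⟩, h, rfl⟩
    simp only [f, AddMonoidHom.coe_mk, ZeroHom.coe_mk, AddMonoidHom.zero_apply] at h
    simp only [AddMonoidHom.coe_fst]
    omega

/-- All digits are smaller than the parameter. -/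
def DigitsOK {ι : Type*} (v : Option ι → ℕ) : Prop :=
  0 < v none ∧ ∀ i, v (some i) < v none

theorem digitsOK_semilinear {ι : Type*} [Finite ι] :
    IsSemilinearSet {v : Option ι → ℕ | DigitsOK v} := by
  classical
  have := Fintype.ofFinite ι
  have h1 := halfspace_semilinear (κ := Option ι) 1 (fun o => if o = none then -1 else 0)
  have h2 : IsSemilinearSet (⋂ i : ι, {v : Option ι → ℕ | 1 + ∑ o, 
      ((if o = none then -1 else 0) + (if o = some i then 1 else 0)) * (v o : ℤ) ≤ 0}) :=
    IsSemilinearSet.iInter fun i => halfspace_semilinear _ _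
  convert! h1.inter h2 using 1
  ext v
  simp only [Set.mem_ofPred_eq, Set.mem_inter_iff, Set.mem_iInter, DigitsOK, add_mul, ite_mul,
    zero_mul, Finset.sum_add_distrib, Finset.sum_ite_eq', Finset.mem_univ, if_true]
  refine and_congr (by omega) (forall_congr' fun i => by omega)

theorem ceil_step (l M t : ℤ) (ht : 0 < t) (c : ℤ) (h1 : (c - 1) * t < l) (h2 : l ≤ c * t) :
    l + t * M ≤ 0 ↔ M + c ≤ 0 := by
  constructor
  · intro h
    by_contra hn
    have : 1 - c ≤ M := by omega
    nlinarith
  · intro h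
    nlinarith

theorem poly_ineq_semilinear {ι : Type*} [Fintype ι] (n : ℕ) (b : Polynomial ℤ)
    (P : ι → Polynomial ℤ) (hb : b.natDegree ≤ n) (hP : ∀ i, (P i).natDegree ≤ n) :
    IsSemilinearSet {v : Option ι → ℕ | DigitsOK v ∧
      b.eval (v none : ℤ) + ∑ i, (P i).eval (v none : ℤ) * (v (some i) : ℤ) ≤ 0} := by
  induction n generalizing b P with
  | zero =>
    have h := (digitsOK_semilinear (ι := ι)).inter (halfspace_semilinear (b.coeff 0)
      (fun o : Option ι => o.elim 0 (fun i => (P i).coeff 0)))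
    convert! h using 1
    ext v
    simp only [Set.mem_ofPred_eq, Set.mem_inter_iff, Fintype.sum_option, Option.elim]
    have hb' := Polynomial.eq_C_of_natDegree_le_zero hb
    have hP' := fun i => Polynomial.eq_C_of_natDegree_le_zero (hP i)
    have e1 : b.eval (v none : ℤ) = b.coeff 0 := by
      conv_lhs => rw [hb']
      simp
    have e2 : ∀ i, (P i).eval (v none : ℤ) = (P i).coeff 0 := by
      intro i
      conv_lhs => rw [hP' i]
      simp
    simp only [e1, e2, zero_mul, zero_add]
  | succ n ih =>
    let C : ℤ := |b.coeff 0| + ∑ i, |(P i).coeff 0|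
    let H : ℤ → Set (Option ι → ℕ) := fun c =>
      ({v | (b.coeff 0) + ∑ o, (Option.elim o (-c) (fun i => (P i).coeff 0)) * (v o : ℤ) ≤ 0} ∩
       {v | (1 - b.coeff 0) + ∑ o, (Option.elim o (c - 1) (fun i => -(P i).coeff 0)) * (v o : ℤ) ≤ 0})
      ∩ {v : Option ι → ℕ | DigitsOK v ∧
      (b.divX + Polynomial.C c).eval (v none : ℤ) +
        ∑ i, (P i).divX.eval (v none : ℤ) * (v (some i) : ℤ) ≤ 0}
    have hH : IsSemilinearSet (⋃ c ∈ Finset.Icc (-C) C, H c) := by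
      refine IsSemilinearSet.biUnion_finset fun c _ => ?_
      refine ((halfspace_semilinear _ _).inter (halfspace_semilinear _ _)).inter (ih _ _ ?_ ?_)
      · refine Polynomial.natDegree_add_le_of_degree_le ?_ (by simp)
        rw [Polynomial.natDegree_divX_eq_natDegree_tsub_one]; omega
      · intro i
        rw [Polynomial.natDegree_divX_eq_natDegree_tsub_one]; have := hP i; omega
    convert! hH using 1
    ext v
    have hdiv : ∀ p : Polynomial ℤ, p.eval (v none : ℤ) =
        p.coeff 0 + (v none : ℤ) * p.divX.eval (v none : ℤ) := by
      intro p
      conv_lhs => rw [← Polynomial.divX_mul_X_add p]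
      simp; ring
    let l : ℤ := b.coeff 0 + ∑ i, (P i).coeff 0 * (v (some i) : ℤ)
    let M : ℤ := b.divX.eval (v none : ℤ) + ∑ i, (P i).divX.eval (v none : ℤ) * (v (some i) : ℤ)
    have e1 : b.eval (v none : ℤ) + ∑ i, (P i).eval (v none : ℤ) * (v (some i) : ℤ)
        = l + (v none : ℤ) * M := by
      rw [hdiv b]
      have : ∑ i, (P i).eval (v none : ℤ) * (v (some i) : ℤ) =
          ∑ i, (P i).coeff 0 * (v (some i) : ℤ) +
          (v none : ℤ) * ∑ i, (P i).divX.eval (v none : ℤ) * (v (some i) : ℤ) := by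
        rw [Finset.mul_sum, ← Finset.sum_add_distrib]
        refine Finset.sum_congr rfl fun i _ => ?_
        rw [hdiv (P i)]; ring
      rw [this]
      simp only [l, M]; ring
    have e2 : ∀ c, v ∈ H c ↔ (((c - 1) * (v none : ℤ) < l ∧ l ≤ c * (v none : ℤ)) ∧
        DigitsOK v ∧ M + c ≤ 0) := by
      intro c
      simp only [H, Set.mem_inter_iff, Set.mem_ofPred_eq, Fintype.sum_option, Option.elim,
        Polynomial.eval_add, Polynomial.eval_C, l, M, neg_mul, Finset.sum_neg_distrib]
      constructor
      · rintro ⟨⟨h1, h2⟩, h3, h4⟩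
        refine ⟨⟨by linarith, by linarith⟩, h3, by linarith⟩
      · rintro ⟨⟨h1, h2⟩, h3, h4⟩
        refine ⟨⟨by linarith, by linarith⟩, h3, by linarith⟩
    simp only [Set.mem_iUnion, e2, Set.mem_ofPred_eq, e1, Finset.mem_Icc]
    constructor
    · rintro ⟨hv, h⟩
      have ht : (0 : ℤ) < v none := by exact_mod_cast hv.1
      -- bound on l
      have hl : |l| ≤ C * (v none : ℤ) := by
        calc |l| ≤ |b.coeff 0| + |∑ i, (P i).coeff 0 * (v (some i) : ℤ)| := abs_add_le _ _
          _ ≤ |b.coeff 0| + ∑ i, |(P i).coeff 0 * (v (some i) : ℤ)| := by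
              gcongr; exact Finset.abs_sum_le_sum_abs _ _
          _ ≤ |b.coeff 0| * (v none : ℤ) + ∑ i, |(P i).coeff 0| * (v none : ℤ) := by
              gcongr with i
              · exact le_mul_of_one_le_right (abs_nonneg _) ht
              · rw [abs_mul]
                gcongr
                rw [Nat.abs_cast]
                exact_mod_cast (hv.2 i).le
          _ = C * (v none : ℤ) := by simp only [C]; rw [add_mul, Finset.sum_mul]
      obtain ⟨hl1, hl2⟩ := abs_le.1 hl
      -- the ceiling
      let c : ℤ := -((-l) / (v none : ℤ))
      have hdm := Int.mul_ediv_add_emod (-l) (v none : ℤ)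
      have hm0 := Int.emod_nonneg (-l) ht.ne'
      have hm1 := Int.emod_lt_of_pos (-l) ht
      have hc1 : (c - 1) * (v none : ℤ) < l := by
        simp only [c]; nlinarith
      have hc2 : l ≤ c * (v none : ℤ) := by
        simp only [c]; nlinarith
      refine ⟨c, ⟨?_, ?_⟩, ⟨hc1, hc2⟩, hv, (ceil_step l M _ ht c hc1 hc2).1 h⟩
      · have : (-C) * (v none : ℤ) ≤ c * v none := by linarith
        exact le_of_mul_le_mul_right this ht
      · have : (c - 1) * (v none : ℤ) < C * v none := by linarith
        have := lt_of_mul_lt_mul_right this ht.le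
        omega
    · rintro ⟨c, _, ⟨hc1, hc2⟩, hv, h⟩
      have ht : (0 : ℤ) < v none := by exact_mod_cast hv.1
      exact ⟨hv, (ceil_step l M _ ht c hc1 hc2).2 h⟩

/-- The number encoded by the digits of variable `j` in base `t`. -/
def num {J : Type*} {K : ℕ} (v : Option (J × Fin K) → ℕ) (j : J) : ℕ :=
  ∑ k : Fin K, v (some (j, k)) * (v none) ^ (k : ℕ)

theorem num_ineq_semilinear {J : Type*} [Fintype J] (K : ℕ) (a : J → Polynomial ℤ)
    (b : Polynomial ℤ) :
    IsSemilinearSet {v : Option (J × Fin K) → ℕ | DigitsOK v ∧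
      ∑ j, (a j).eval (v none : ℤ) * (num v j : ℤ) ≤ b.eval (v none : ℤ)} := by
  let P : J × Fin K → Polynomial ℤ := fun p => a p.1 * Polynomial.X ^ (p.2 : ℕ)
  have h := poly_ineq_semilinear ((-b).natDegree + ∑ p, (P p).natDegree) (-b) P (by omega)
    (fun i => le_add_left (Finset.single_le_sum (f := fun p => (P p).natDegree)
      (fun _ _ => Nat.zero_le _) (Finset.mem_univ i)))
  convert! h using 1
  ext v
  simp only [Set.mem_ofPred_eq]
  refine and_congr_right fun _ => ?_
  have : ∑ p, (P p).eval (v none : ℤ) * (v (some p) : ℤ) =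
      ∑ j, (a j).eval (v none : ℤ) * (num v j : ℤ) := by
    rw [Fintype.sum_prod_type]
    refine Finset.sum_congr rfl fun j _ => ?_
    simp only [num, P]
    push_cast
    rw [Finset.mul_sum]
    refine Finset.sum_congr rfl fun k _ => ?_
    simp; ring
  rw [this]
  simp only [Polynomial.eval_neg]
  constructor <;> intro h <;> linarith


theorem poly_growth (q : Polynomial ℤ) :
    ∃ K N : ℕ, ∀ t : ℕ, N ≤ t → ∀ K', K ≤ K' → |q.eval (t : ℤ)| < (t : ℤ) ^ K' := by
  refine ⟨q.natDegree + 1, (∑ i ∈ Finset.range (q.natDegree + 1), |q.coeff i|).toNat + 1,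
    fun t ht K' hK => ?_⟩
  have h1 : (1 : ℤ) ≤ t := by omega
  have h2 : ∑ i ∈ Finset.range (q.natDegree + 1), |q.coeff i| < t := by omega
  calc |q.eval (t : ℤ)| ≤ ∑ i ∈ Finset.range (q.natDegree + 1), |q.coeff i * (t : ℤ) ^ i| := by
        rw [Polynomial.eval_eq_sum_range]; exact Finset.abs_sum_le_sum_abs _ _
    _ ≤ ∑ i ∈ Finset.range (q.natDegree + 1), |q.coeff i| * (t : ℤ) ^ q.natDegree := by
        refine Finset.sum_le_sum fun i hi => ?_
        rw [abs_mul, abs_of_nonneg (a := (t : ℤ) ^ i) (by positivity)]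
        gcongr
        rw [Finset.mem_range] at hi; omega
    _ = (∑ i ∈ Finset.range (q.natDegree + 1), |q.coeff i|) * (t : ℤ) ^ q.natDegree := by
        rw [Finset.sum_mul]
    _ < t * (t : ℤ) ^ q.natDegree := by
        gcongr
    _ = (t : ℤ) ^ (q.natDegree + 1) := by ring
    _ ≤ (t : ℤ) ^ K' := by gcongr

theorem poly_growth_family {σ : Type*} [Finite σ] (q : σ → Polynomial ℤ) :
    ∃ K N : ℕ, 1 ≤ N ∧
      ∀ t : ℕ, N ≤ t → ∀ s, ∀ K', K ≤ K' → |(q s).eval (t : ℤ)| < (t : ℤ) ^ K' := by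
  have := Fintype.ofFinite σ
  choose K N h using fun s => poly_growth (q s)
  refine ⟨∑ s, K s, 1 + ∑ s, N s, by omega, fun t ht s K' hK => h s t ?_ K' ?_⟩
  · have := Finset.single_le_sum (f := N) (fun _ _ => Nat.zero_le _) (Finset.mem_univ s)
    omega
  · have := Finset.single_le_sum (f := K) (fun _ _ => Nat.zero_le _) (Finset.mem_univ s)
    omega

theorem exists_basic {P J : Type*} [Fintype J] (A : Matrix P J ℝ) (b : P → ℝ) (j : J) (C : ℝ)
    (hC : ∀ x : J → ℝ, (∀ i, 0 ≤ x i) → A.mulVec x = b → x j ≤ C)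
    (x : J → ℝ) (hx : ∀ i, 0 ≤ x i) (hAx : A.mulVec x = b) :
    ∃ y : J → ℝ, (∀ i, 0 ≤ y i) ∧ A.mulVec y = b ∧ x j ≤ y j ∧
      ∀ v : J → ℝ, (∀ i, y i = 0 → v i = 0) → A.mulVec v = 0 → v = 0 := by
  classical
  induction hn : (Finset.univ.filter (fun i => x i ≠ 0)).card using Nat.strong_induction_on
    generalizing x with
  | _ n ih =>
  by_cases hind : ∀ v : J → ℝ, (∀ i, x i = 0 → v i = 0) → A.mulVec v = 0 → v = 0
  · exact ⟨x, hx, hAx, le_rfl, hind⟩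
  · push Not at hind
    obtain ⟨v, hv0, hAv, hvne⟩ := hind
    -- choose sign
    obtain ⟨u, hu0, hAu, huj, i0, hi0⟩ : ∃ u : J → ℝ, (∀ i, x i = 0 → u i = 0) ∧
        A.mulVec u = 0 ∧ 0 ≤ u j ∧ ∃ i, u i < 0 := by
      have main : ∀ v : J → ℝ, (∀ i, x i = 0 → v i = 0) → A.mulVec v = 0 → 0 < v j →
          ∃ i, v i < 0 := by
        intro v hv0 hAv hj
        by_contra hneg
        push Not at hneg
        have := hC (fun i => x i + ((C - x j) / v j + 1) * v i) (fun i => ?_) ?_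
        · have h2 : ((C - x j) / v j + 1) * v j = C - x j + v j := by field_simp
          linarith
        · have h3 := hC x hx hAx
          have : 0 ≤ (C - x j) / v j := div_nonneg (by linarith) hj.le
          have := hneg i
          have := hx i
          positivity
        · have : (fun i => x i + ((C - x j) / v j + 1) * v i) =
              x + ((C - x j) / v j + 1) • v := by ext i; simp
          rw [this, Matrix.mulVec_add, Matrix.mulVec_smul, hAv, hAx]; simp
      have hneg0 : ∀ i, x i = 0 → (-v) i = 0 := fun i hi => by simp [hv0 i hi]
      have hAneg : A.mulVec (-v) = 0 := by rw [Matrix.mulVec_neg, hAv, neg_zero]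
      rcases lt_trichotomy (v j) 0 with h | h | h
      · exact ⟨-v, hneg0, hAneg, by simp [h.le], main _ hneg0 hAneg (by simpa using h)⟩
      · obtain ⟨i, hi⟩ := Function.ne_iff.1 hvne
        rcases lt_or_gt_of_ne hi with hi | hi
        · exact ⟨v, hv0, hAv, h.ge, i, hi⟩
        · exact ⟨-v, hneg0, hAneg, by simp [h], i, by simpa using hi⟩
      · exact ⟨v, hv0, hAv, h.le, main v hv0 hAv h⟩
    -- move
    obtain ⟨k, hk, hmin⟩ := Finset.exists_min_image (Finset.univ.filter (fun i => u i < 0))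
      (fun i => x i / (- u i)) ⟨i0, by simpa using hi0⟩
    simp only [Finset.mem_filter, Finset.mem_univ, true_and] at hk hmin
    let lam := x k / (- u k)
    have hlam : 0 ≤ lam := div_nonneg (hx k) (by linarith)
    let y : J → ℝ := fun i => x i + lam * u i
    have hy : ∀ i, 0 ≤ y i := by
      intro i
      rcases lt_or_ge (u i) 0 with h | h
      · have := hmin i h
        rw [le_div_iff₀ (by linarith)] at this
        simp only [y, lam]; linarith
      · have := hx i
        simp only [y]; positivity
    have hAy : A.mulVec y = b := by
      have : y = x + lam • u := by ext i; simp [y]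
      rw [this, Matrix.mulVec_add, Matrix.mulVec_smul, hAu, hAx]; simp
    have hyk : y k = 0 := by
      have : u k ≠ 0 := hk.ne
      simp only [y, lam]; field_simp; ring
    have hxk : x k ≠ 0 := fun h => hk.ne (hu0 k h)
    have hlt : (Finset.univ.filter (fun i => y i ≠ 0)).card < n := by
      rw [← hn]
      apply Finset.card_lt_card
      rw [Finset.ssubset_iff_of_subset]
      · exact ⟨k, by simpa using hxk, by simpa using hyk⟩
      · intro i
        simp only [Finset.mem_filter, Finset.mem_univ, true_and]
        intro hyi hxi
        apply hyi
        simp [y, hxi, hu0 i hxi]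
    obtain ⟨z, h1, h2, h3, h4⟩ := ih _ hlt y hy hAy rfl
    refine ⟨z, h1, h2, le_trans ?_ h3, h4⟩
    simp only [y]
    have : 0 ≤ lam * u j := by positivity
    linarith

theorem poly_bound {P J : Type*} [Fintype P] [Fintype J] (A : Matrix P J (Polynomial ℤ))
    (b : P → Polynomial ℤ) :
    ∃ K N : ℕ, 1 ≤ N ∧ ∀ t : ℕ, N ≤ t → ∀ C : ℝ,
      (∀ x : J → ℝ, (∀ i, 0 ≤ x i) →
        (∀ i, ∑ j, (((A i j).eval (t : ℤ) : ℤ) : ℝ) * x j = (((b i).eval (t : ℤ) : ℤ) : ℝ)) →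
        ∀ j, x j ≤ C) →
      ∀ K', K ≤ K' → ∀ x : J → ℝ, (∀ i, 0 ≤ x i) →
        (∀ i, ∑ j, (((A i j).eval (t : ℤ) : ℤ) : ℝ) * x j = (((b i).eval (t : ℤ) : ℤ) : ℝ)) →
        ∀ j, x j < (t : ℝ) ^ K' := by
  classical
  let B : (S : Finset J) → Matrix P S (Polynomial ℤ) := fun S => A.submatrix id Subtype.val
  let q : (Σ S : Finset J, S) → Polynomial ℤ := fun s =>
    (((B s.1).transpose * B s.1).adjugate.mulVec ((B s.1).transpose.mulVec b)) s.2
  obtain ⟨K, N, hN, h⟩ := poly_growth_family q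
  refine ⟨K, N, hN, fun t ht C hC K' hK x hx hAx j => ?_⟩
  let φ : Polynomial ℤ →+* ℝ := (Int.castRingHom ℝ).comp (Polynomial.evalRingHom (t : ℤ))
  have hφ : ∀ p : Polynomial ℤ, φ p = ((p.eval (t : ℤ) : ℤ) : ℝ) := fun p => by simp [φ]
  let A' : Matrix P J ℝ := A.map φ
  let b' : P → ℝ := fun i => φ (b i)
  have hiff : ∀ x : J → ℝ, A'.mulVec x = b' ↔
      ∀ i, ∑ j, (((A i j).eval (t : ℤ) : ℤ) : ℝ) * x j = (((b i).eval (t : ℤ) : ℤ) : ℝ) := by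
    intro x
    rw [funext_iff]
    simp only [Matrix.mulVec, dotProduct, A', b', Matrix.map_apply, hφ]
  obtain ⟨y, hy, hAy, hxy, hind⟩ := exists_basic A' b' j C
    (fun x hx hAx => hC x hx ((hiff x).1 hAx) j) x hx ((hiff x).2 hAx)
  refine lt_of_le_of_lt hxy ?_
  have htpos : (0 : ℝ) < t := by
    have : 0 < t := by omega
    exact_mod_cast this
  by_cases hyj : y j = 0
  · rw [hyj]; positivity
  let S : Finset J := Finset.univ.filter (fun i => y i ≠ 0)
  have hjS : j ∈ S := by simpa [S] using hyj
  let BR : Matrix P S ℝ := (B S).map φ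
  let yS : S → ℝ := fun i => y i
  have hBy : BR.mulVec yS = b' := by
    rw [← hAy]
    ext i
    simp only [Matrix.mulVec, dotProduct, BR, B, Matrix.map_apply, Matrix.submatrix_apply, id, A',
      yS]
    rw [Finset.sum_coe_sort S (fun k => φ (A i k) * y k)]
    apply Finset.sum_subset (Finset.subset_univ _)
    intro k _ hk
    have : y k = 0 := by simpa [S] using hk
    simp [this]
  let G : Matrix S S ℝ := BR.transpose * BR
  have hdet : G.det ≠ 0 := by
    intro hd
    obtain ⟨u, hu, hGu⟩ := Matrix.exists_mulVec_eq_zero_iff.2 hd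
    apply hu
    have hBu : BR.mulVec u = 0 := by
      have h1 : dotProduct (BR.mulVec u) (BR.mulVec u) = 0 := by
        rw [Matrix.dotProduct_mulVec, Matrix.vecMul_mulVec, ← Matrix.dotProduct_mulVec]
        change dotProduct u (G.mulVec u) = 0
        rw [hGu]; simp
      exact dotProduct_self_eq_zero.1 h1
    let v : J → ℝ := fun i => if hi : i ∈ S then u ⟨i, hi⟩ else 0
    have hv : v = 0 := by
      apply hind
      · intro i hi
        have : i ∉ S := by simpa [S] using hi
        simp [v, this]
      · rw [← hBu]
        ext i
        simp only [Matrix.mulVec, dotProduct, BR, B, Matrix.map_apply, Matrix.submatrix_apply, id,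
          A']
        rw [← Finset.sum_subset (Finset.subset_univ S), ← Finset.sum_coe_sort S]
        · refine Finset.sum_congr rfl fun k _ => ?_
          simp [v]
        · intro k _ hk
          simp [v, hk]
    ext i
    have := congrFun hv i
    simpa [v] using this
  have hGφ : G = ((B S).transpose * B S).map φ := by
    rw [Matrix.map_mul]; rfl
  have hdetφ : G.det = ((((B S).transpose * B S).det.eval (t : ℤ) : ℤ) : ℝ) := by
    rw [hGφ, ← hφ, RingHom.map_det]; rfl
  have hcr : G.adjugate.mulVec (BR.transpose.mulVec b') = G.det • yS := by
    rw [← hBy, Matrix.mulVec_mulVec, Matrix.mulVec_mulVec]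
    rw [Matrix.mul_assoc]
    change (G.adjugate * G).mulVec yS = _
    rw [Matrix.adjugate_mul, Matrix.smul_mulVec, Matrix.one_mulVec]
  have hq : (((q ⟨S, ⟨j, hjS⟩⟩).eval (t : ℤ) : ℤ) : ℝ) = G.det * y j := by
    have h1 := congrFun hcr ⟨j, hjS⟩
    have h2 : (G.det • yS) ⟨j, hjS⟩ = G.det * y j := by simp [yS]
    rw [← h2, ← h1, ← hφ]
    simp only [q]
    rw [RingHom.map_mulVec]
    congr 1
    · rw [hGφ]
      have := φ.map_adjugate ((B S).transpose * B S)
      simp only [RingHom.mapMatrix_apply] at this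
      rw [this]
    · ext k
      simp only [Function.comp]
      rw [RingHom.map_mulVec]
      rfl
  have hb := h t ht ⟨S, ⟨j, hjS⟩⟩ K' hK
  have hb' : |(((q ⟨S, ⟨j, hjS⟩⟩).eval (t : ℤ) : ℤ) : ℝ)| < (t : ℝ) ^ K' := by exact_mod_cast hb
  rw [hq, abs_mul] at hb'
  have hd1 : 1 ≤ |G.det| := by
    rw [hdetφ] at hdet ⊢
    have : (((B S).transpose * B S).det.eval (t : ℤ)) ≠ 0 := by exact_mod_cast hdet
    exact_mod_cast Int.one_le_abs this
  calc y j ≤ |y j| := le_abs_self _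
    _ ≤ |G.det| * |y j| := le_mul_of_one_le_left (abs_nonneg _) hd1
    _ < _ := hb'


theorem num_inj {J : Type*} {K : ℕ} {v w : Option (J × Fin K) → ℕ} (hv : DigitsOK v)
    (hw : DigitsOK w) (h0 : v none = w none) (h : ∀ j, num v j = num w j) : v = w := by
  funext o
  rcases o with _ | ⟨j, k⟩
  · exact h0
  · let f : Fin K → Fin (w none) := fun k => ⟨v (some (j, k)), h0 ▸ hv.2 (j, k)⟩
    let g : Fin K → Fin (w none) := fun k => ⟨w (some (j, k)), hw.2 (j, k)⟩
    have hfg : finFunctionFinEquiv f = finFunctionFinEquiv g := by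
      apply Fin.ext
      rw [finFunctionFinEquiv_apply, finFunctionFinEquiv_apply]
      have := h j
      simp only [num, h0] at this
      exact this
    have := congrFun (finFunctionFinEquiv.injective hfg) k
    simpa [f, g] using this

theorem num_surj {J : Type*} {K : ℕ} {t : ℕ} (ht : 0 < t) (x : J → ℕ) (hx : ∀ j, x j < t ^ K) :
    ∃ v : Option (J × Fin K) → ℕ, DigitsOK v ∧ v none = t ∧ ∀ j, num v j = x j := by
  let f : J → Fin K → Fin t := fun j => finFunctionFinEquiv.symm ⟨x j, hx j⟩
  refine ⟨fun o => o.elim t (fun p => f p.1 p.2), ⟨ht, fun p => (f p.1 p.2).2⟩, rfl, fun j => ?_⟩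
  have h : ((finFunctionFinEquiv (f j) : Fin (t ^ K)) : ℕ) = x j := by
    simp only [f, Equiv.apply_symm_apply]
  rw [← h, finFunctionFinEquiv_apply]
  rfl

theorem le_ncard_iff_fin {α : Type*} {s : Set α} (hs : s.Finite) (m : ℕ) :
    m ≤ s.ncard ↔ ∃ f : Fin m → α, Function.Injective f ∧ ∀ i, f i ∈ s := by
  constructor
  · intro h
    obtain ⟨u, hu, hc⟩ := Set.exists_subset_card_eq h
    have hf : u.Finite := hs.subset hu
    have := hf.to_subtype
    have e := Finite.equivFinOfCardEq (α := u) (n := m) (by rw [← hc]; rfl)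
    exact ⟨fun i => (e.symm i : α), fun i j hij => e.symm.injective (Subtype.ext hij),
      fun i => hu (e.symm i).2⟩
  · rintro ⟨f, hf, hm⟩
    have h1 : (Set.range f).ncard = m := by
      rw [Set.ncard_range_of_injective hf]; simp
    rw [← h1]
    exact Set.ncard_le_ncard (by rintro _ ⟨i, rfl⟩; exact hm i) hs

theorem bound_L1 {n1 n2 p1 : ℕ}
    (A1 : Matrix (Fin p1) (Fin n2 ⊕ Fin n1) (Polynomial ℤ)) (b1 : Fin p1 → Polynomial ℤ)
    (hbdd1 : ∀ t : ℕ, 0 < t → Bornology.IsBounded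
      {x : (Fin n2 ⊕ Fin n1) → ℝ | (∀ j, 0 ≤ x j) ∧
        ∀ i, ∑ j, (evalAt (A1 i j) t : ℝ) * x j = (evalAt (b1 i) t : ℝ)}) :
    ∃ K N : ℕ, 1 ≤ N ∧ ∀ t : ℕ, N ≤ t → ∀ K', K ≤ K' → ∀ x ∈ latticeL1 A1 b1 t,
      ∀ j, x j < (t : ℤ) ^ K' := by
  obtain ⟨K, N, hN, h⟩ := poly_bound A1 b1
  refine ⟨K, N, hN, fun t ht K' hK x hx j => ?_⟩
  obtain ⟨C, hC⟩ := (hbdd1 t (by omega)).exists_norm_le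
  have := h t ht C (fun x hx hA j => ?_) K' hK (fun j => (x j : ℝ)) (fun i => ?_) (fun i => ?_) j
  · exact_mod_cast this
  · exact (le_abs_self _).trans ((norm_le_pi_norm x j).trans (hC x ⟨hx, hA⟩))
  · exact_mod_cast hx.1 i
  · exact_mod_cast hx.2 i

theorem bound_L2 {n2 p2 : ℕ}
    (A2 : Matrix (Fin p2) (Fin n2) (Polynomial ℤ)) (b2 : Fin p2 → Polynomial ℤ)
    (hbdd2 : ∀ t : ℕ, 0 < t → Bornology.IsBounded
      {x : Fin n2 → ℝ | (∀ j, 0 ≤ x j) ∧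
        ∀ i, ∑ j, (evalAt (A2 i j) t : ℝ) * x j ≤ (evalAt (b2 i) t : ℝ)}) :
    ∃ K N : ℕ, 1 ≤ N ∧ ∀ t : ℕ, N ≤ t → ∀ K', K ≤ K' → ∀ x ∈ latticeL2 A2 b2 t,
      ∀ j, x j < (t : ℤ) ^ K' := by
  classical
  obtain ⟨K, N, hN, h⟩ := poly_bound
    (Matrix.of (fun (i : Fin p2) (j : Fin n2 ⊕ Fin p2) =>
      Sum.elim (fun j => A2 i j) (fun k => if i = k then (1 : Polynomial ℤ) else 0) j)) b2
  have key : ∀ (t : ℕ) (x : Fin n2 ⊕ Fin p2 → ℝ) (i : Fin p2),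
      ∑ j, ((((Matrix.of (fun (i : Fin p2) (j : Fin n2 ⊕ Fin p2) =>
      Sum.elim (fun j => A2 i j) (fun k => if i = k then (1 : Polynomial ℤ) else 0) j)) i j).eval
        (t : ℤ) : ℤ) : ℝ) * x j =
      ∑ j, (evalAt (A2 i j) t : ℝ) * x (Sum.inl j) + x (Sum.inr i) := by
    intro t x i
    rw [Fintype.sum_sum_type]
    congr 1
    rw [Finset.sum_eq_single i]
    · simp
    · intro k _ hk
      simp [hk.symm]
    · simp
  simp only [key] at h
  refine ⟨K, N, hN, fun t ht K' hK x hx j => ?_⟩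
  obtain ⟨C, hC⟩ := (hbdd2 t (by omega)).exists_norm_le
  have hcoord : ∀ x : Fin n2 ⊕ Fin p2 → ℝ, (∀ i, 0 ≤ x i) →
      (∀ i, ∑ j, (evalAt (A2 i j) t : ℝ) * x (Sum.inl j) + x (Sum.inr i) =
        (((b2 i).eval (t : ℤ) : ℤ) : ℝ)) → ∀ j, |x (Sum.inl j)| ≤ C := by
    intro x hx hA j
    refine (norm_le_pi_norm (fun j => x (Sum.inl j)) j).trans (hC _ ⟨fun j => hx _, fun i => ?_⟩)
    have h1 := hA i
    have h2 := hx (Sum.inr i)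
    change _ ≤ (((b2 i).eval (t : ℤ) : ℤ) : ℝ)
    linarith
  let D : Fin p2 → ℝ := fun i => |(((b2 i).eval (t : ℤ) : ℤ) : ℝ)| +
    ∑ j, |(evalAt (A2 i j) t : ℝ)| * |C|
  have hD : ∀ i, 0 ≤ D i := fun i => by positivity
  have := h t ht (|C| + ∑ i, D i) (fun x hx hA j => ?_) K' hK
    (Sum.elim (fun j => (x j : ℝ))
      (fun i => (evalAt (b2 i) t : ℝ) - ∑ j, (evalAt (A2 i j) t : ℝ) * x j))
    (fun i => ?_) (fun i => ?_) (Sum.inl j)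
  · simp only [Sum.elim_inl] at this
    exact_mod_cast this
  · have hs : 0 ≤ ∑ i, D i := Finset.sum_nonneg fun i _ => hD i
    rcases j with j | i
    · have h1 := hcoord x hx hA j
      have h2 := le_abs_self (x (Sum.inl j))
      have h3 := le_abs_self C
      linarith
    · have h1 := hA i
      have h2 : -∑ j, (evalAt (A2 i j) t : ℝ) * x (Sum.inl j) ≤
          ∑ j, |(evalAt (A2 i j) t : ℝ)| * |C| := by
        rw [← Finset.sum_neg_distrib]
        refine Finset.sum_le_sum fun j _ => ?_
        calc -((evalAt (A2 i j) t : ℝ) * x (Sum.inl j))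
            ≤ |(evalAt (A2 i j) t : ℝ) * x (Sum.inl j)| := neg_le_abs _
          _ = |(evalAt (A2 i j) t : ℝ)| * |x (Sum.inl j)| := abs_mul _ _
          _ ≤ _ := by
            have := (hcoord x hx hA j).trans (le_abs_self C)
            gcongr
      have h3 : D i ≤ ∑ i, D i :=
        Finset.single_le_sum (f := D) (fun i _ => hD i) (Finset.mem_univ i)
      have h4 := le_abs_self (((b2 i).eval (t : ℤ) : ℤ) : ℝ)
      have h5 := abs_nonneg C
      have h6 : D i = |(((b2 i).eval (t : ℤ) : ℤ) : ℝ)| +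
        ∑ j, |(evalAt (A2 i j) t : ℝ)| * |C| := rfl
      linarith
  · rcases i with j | i
    · simp only [Sum.elim_inl]
      exact_mod_cast hx.1 j
    · simp only [Sum.elim_inr, sub_nonneg]
      exact_mod_cast hx.2 i
  · simp only [Sum.elim_inl, Sum.elim_inr]
    simp [evalAt]

/-- the encoded version of `latticeL1` -/
def encL1 {n1 n2 p1 : ℕ} (K : ℕ)
    (A1 : Matrix (Fin p1) (Fin n2 ⊕ Fin n1) (Polynomial ℤ)) (b1 : Fin p1 → Polynomial ℤ) :
    Set (Option ((Fin n2 ⊕ Fin n1) × Fin K) → ℕ) :=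
  {w | DigitsOK w ∧ (fun j => (num w j : ℤ)) ∈ latticeL1 A1 b1 (w none)}

theorem encL1_semilinear {n1 n2 p1 : ℕ} (K : ℕ)
    (A1 : Matrix (Fin p1) (Fin n2 ⊕ Fin n1) (Polynomial ℤ)) (b1 : Fin p1 → Polynomial ℤ) :
    IsSemilinearSet (encL1 K A1 b1) := by
  have h1 := IsSemilinearSet.iInter fun i => num_ineq_semilinear K (A1 i) (b1 i)
  have h2 := IsSemilinearSet.iInter fun i => num_ineq_semilinear K (fun j => - A1 i j) (- b1 i)
  convert! (digitsOK_semilinear.inter h1).inter h2 using 1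
  ext w
  simp only [encL1, latticeL1, evalAt, Set.mem_ofPred_eq, Set.mem_inter_iff, Set.mem_iInter,
    Polynomial.eval_neg, neg_mul, Finset.sum_neg_distrib, neg_le_neg_iff]
  constructor
  · rintro ⟨h, -, h3⟩
    exact ⟨⟨h, fun i => ⟨h, (h3 i).le⟩⟩, fun i => ⟨h, (h3 i).ge⟩⟩
  · rintro ⟨⟨h, h3⟩, h4⟩
    exact ⟨h, fun j => by positivity, fun i => le_antisymm (h3 i).2 (h4 i).2⟩

/-- the encoded version of `latticeL2` -/
def encL2 {n2 p2 : ℕ} (K : ℕ)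
    (A2 : Matrix (Fin p2) (Fin n2) (Polynomial ℤ)) (b2 : Fin p2 → Polynomial ℤ) :
    Set (Option (Fin n2 × Fin K) → ℕ) :=
  {w | DigitsOK w ∧ (fun j => (num w j : ℤ)) ∈ latticeL2 A2 b2 (w none)}

theorem encL2_semilinear {n2 p2 : ℕ} (K : ℕ)
    (A2 : Matrix (Fin p2) (Fin n2) (Polynomial ℤ)) (b2 : Fin p2 → Polynomial ℤ) :
    IsSemilinearSet (encL2 K A2 b2) := by
  have h1 := IsSemilinearSet.iInter fun i => num_ineq_semilinear K (A2 i) (b2 i)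
  convert! (digitsOK_semilinear.inter h1) using 1
  ext w
  simp only [encL2, latticeL2, evalAt, Set.mem_ofPred_eq, Set.mem_inter_iff, Set.mem_iInter]
  constructor
  · rintro ⟨h, -, h3⟩
    exact ⟨h, fun i => ⟨h, h3 i⟩⟩
  · rintro ⟨h, h3⟩
    exact ⟨h, fun j => by positivity, fun i => (h3 i).2⟩

/-- restriction of an encoded vector along a map of index sets -/
def restr {J J' : Type*} (K : ℕ) (e : J → J') :
    (Option (J' × Fin K) → ℕ) →ₗ[ℕ] (Option (J × Fin K) → ℕ) :=
  LinearMap.funLeft ℕ ℕ (Option.map (Prod.map e id))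

theorem restr_none {J J' : Type*} {K : ℕ} (e : J → J') (v : Option (J' × Fin K) → ℕ) :
    restr K e v none = v none := rfl

theorem restr_some {J J' : Type*} {K : ℕ} (e : J → J') (v : Option (J' × Fin K) → ℕ) (j : J)
    (k : Fin K) : restr K e v (some (j, k)) = v (some (e j, k)) := rfl

theorem restr_num {J J' : Type*} {K : ℕ} (e : J → J') (v : Option (J' × Fin K) → ℕ) (j : J) :
    num (restr K e v) j = num v (e j) := rfl

/-- encoded families of `m` distinct points of `latticeL1` with the same projection -/
def encFam {n1 n2 p1 : ℕ} (m K : ℕ)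
    (A1 : Matrix (Fin p1) (Fin n2 ⊕ Fin n1) (Polynomial ℤ)) (b1 : Fin p1 → Polynomial ℤ) :
    Set (Option ((Fin n2 ⊕ (Fin m × Fin n1)) × Fin K) → ℕ) :=
  {v | (∀ i : Fin m, restr K (Sum.map id (Prod.mk i)) v ∈ encL1 K A1 b1) ∧
    ∀ p : {p : Fin m × Fin m // p.1 ≠ p.2},
      restr K (Sum.map id (Prod.mk p.1.1)) v ≠
        restr K (Sum.map (id : Fin n2 → Fin n2) (Prod.mk (β := Fin n1) p.1.2)) v}

theorem encFam_semilinear {n1 n2 p1 : ℕ} (m K : ℕ)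
    (A1 : Matrix (Fin p1) (Fin n2 ⊕ Fin n1) (Polynomial ℤ)) (b1 : Fin p1 → Polynomial ℤ) :
    IsSemilinearSet (encFam m K A1 b1) := by
  have h1 := IsSemilinearSet.iInter fun i : Fin m =>
    (encL1_semilinear K A1 b1).preimage (restr K (Sum.map id (Prod.mk i)))
  have h2 := IsSemilinearSet.iInter fun p : {p : Fin m × Fin m // p.1 ≠ p.2} =>
    (isSemilinearSet_setOfPred_eq 0 0
      (restr K (Sum.map (id : Fin n2 → Fin n2) (Prod.mk (β := Fin n1) p.1.1)))
      (restr K (Sum.map (id : Fin n2 → Fin n2) (Prod.mk (β := Fin n1) p.1.2)))).compl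
  convert! h1.inter h2 using 1
  ext w
  simp [encFam]

theorem mem_encFam_image {n1 n2 p1 : ℕ} (m K : ℕ)
    (A1 : Matrix (Fin p1) (Fin n2 ⊕ Fin n1) (Polynomial ℤ)) (b1 : Fin p1 → Polynomial ℤ)
    (u : Option (Fin n2 × Fin K) → ℕ) :
    u ∈ restr K Sum.inl '' encFam m K A1 b1 ↔
      ∃ f : Fin m → (Option ((Fin n2 ⊕ Fin n1) × Fin K) → ℕ), Function.Injective f ∧
        ∀ i, f i ∈ encL1 K A1 b1 ∧ restr K Sum.inl (f i) = u := by
  constructor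
  · rintro ⟨v, ⟨hv1, hv2⟩, rfl⟩
    refine ⟨fun i => restr K (Sum.map id (Prod.mk i)) v, fun i i' h => ?_, fun i => ⟨hv1 i, ?_⟩⟩
    · by_contra hne
      exact hv2 ⟨(i, i'), hne⟩ h
    · funext o
      rcases o with _ | ⟨j, k⟩ <;> rfl
  · rintro ⟨f, hf, h⟩
    let v : Option ((Fin n2 ⊕ (Fin m × Fin n1)) × Fin K) → ℕ := fun o =>
      o.elim (u none) (fun p => Sum.elim (fun j => u (some (j, p.2)))
        (fun q => f q.1 (some (Sum.inr q.2, p.2))) p.1)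
    have hv : ∀ i, restr K (Sum.map id (Prod.mk i)) v = f i := by
      intro i
      have hu := (h i).2
      funext o
      rcases o with _ | ⟨j | j, k⟩
      · rw [restr_none, ← restr_none Sum.inl (f i), hu]; rfl
      · rw [restr_some, ← restr_some Sum.inl (f i), hu]; rfl
      · rw [restr_some]; rfl
    refine ⟨v, ⟨fun i => ?_, fun p => ?_⟩, ?_⟩
    · rw [hv]; exact (h i).1
    · rw [hv, hv]; exact fun e => p.2 (hf e)
    · funext o
      rcases o with _ | ⟨j, k⟩ <;> rfl


theorem digits_finite {ι : Type*} [Finite ι] (t : ℕ) :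
    {v : Option ι → ℕ | DigitsOK v ∧ v none = t}.Finite := by
  have := Fintype.ofFinite ι
  classical
  refine (Set.finite_Iic (fun _ : Option ι => t)).subset ?_
  rintro v ⟨hv, rfl⟩ o
  rcases o with _ | i
  · exact le_rfl
  · exact (hv.2 i).le

theorem fiber_ncard {n1 n2 p1 : ℕ} (K t : ℕ) (ht : 0 < t)
    (A1 : Matrix (Fin p1) (Fin n2 ⊕ Fin n1) (Polynomial ℤ)) (b1 : Fin p1 → Polynomial ℤ)
    (hb : ∀ x ∈ latticeL1 A1 b1 t, ∀ j, x j < (t : ℤ) ^ K)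
    (u : Option (Fin n2 × Fin K) → ℕ) (hu : DigitsOK u) (hut : u none = t) :
    {w | w ∈ encL1 K A1 b1 ∧ restr K Sum.inl w = u}.ncard =
      {x3 : Fin n1 → ℤ | Sum.elim (fun j => (num u j : ℤ)) x3 ∈ latticeL1 A1 b1 t}.ncard := by
  have hnone : ∀ w : Option ((Fin n2 ⊕ Fin n1) × Fin K) → ℕ, restr K Sum.inl w = u →
      w none = t := by
    intro w hw
    rw [← hut, ← hw]; rfl
  refine Set.ncard_congr (fun w _ k => (num w (Sum.inr k) : ℤ)) ?_ ?_ ?_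
  · rintro w ⟨⟨hw, hL⟩, hr⟩
    rw [hnone w hr] at hL
    simp only [Set.mem_ofPred_eq]
    convert! hL using 1
    funext j
    rcases j with j | k
    · simp only [Sum.elim_inl, ← hr, restr_num]
    · rfl
  · rintro w w' ⟨⟨hw, hL⟩, hr⟩ ⟨⟨hw', hL'⟩, hr'⟩ h
    refine num_inj hw hw' ((hnone w hr).trans (hnone w' hr').symm) fun j => ?_
    rcases j with j | k
    · rw [← restr_num Sum.inl w, ← restr_num Sum.inl w', hr, hr']
    · exact_mod_cast congrFun h k
  · intro x3 hx
    have hx' : Sum.elim (fun j => (num u j : ℤ)) x3 ∈ latticeL1 A1 b1 t := hx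
    have hlt := hb _ hx'
    obtain ⟨w, hw, hwt, hnum⟩ := num_surj (K := K) ht
      (fun j => (Sum.elim (fun j => (num u j : ℤ)) x3 j).toNat) (fun j => by
        have h1 := hlt j
        have h2 := hx'.1 j
        zify
        rw [Int.toNat_of_nonneg h2]
        exact h1)
    have hz : ∀ j, (num w j : ℤ) = Sum.elim (fun j => (num u j : ℤ)) x3 j := by
      intro j
      rw [hnum j]
      exact Int.toNat_of_nonneg (hx'.1 j)
    refine ⟨w, ⟨⟨hw, ?_⟩, ?_⟩, ?_⟩
    · rw [hwt, funext hz]; exact hx'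
    · refine num_inj ⟨hw.1, fun p => hw.2 (Sum.inl p.1, p.2)⟩ hu (hwt.trans hut.symm) fun j => ?_
      rw [restr_num]
      exact Int.ofNat_inj.1 (hz (Sum.inl j))
    · funext k
      exact hz (Sum.inr k)

theorem exclusion_size_eqp (m n1 n2 p1 p2 : ℕ)
    (hm : 0 < m) (hn1 : 0 < n1) (hn2 : 0 < n2) (hp1 : 0 < p1) (hp2 : 0 < p2)
    (A1 : Matrix (Fin p1) (Fin n2 ⊕ Fin n1) (Polynomial ℤ)) (b1 : Fin p1 → Polynomial ℤ)
    (A2 : Matrix (Fin p2) (Fin n2) (Polynomial ℤ)) (b2 : Fin p2 → Polynomial ℤ)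
    (hbdd1 : ∀ t : ℕ, 0 < t → Bornology.IsBounded
      {x : (Fin n2 ⊕ Fin n1) → ℝ | (∀ j, 0 ≤ x j) ∧
        ∀ i, ∑ j, (evalAt (A1 i j) t : ℝ) * x j = (evalAt (b1 i) t : ℝ)})
    (hbdd2 : ∀ t : ℕ, 0 < t → Bornology.IsBounded
      {x : Fin n2 → ℝ | (∀ j, 0 ≤ x j) ∧
        ∀ i, ∑ j, (evalAt (A2 i j) t : ℝ) * x j ≤ (evalAt (b2 i) t : ℝ)}) :
    IsEQP (fun t => ((latticeL3 m A1 b1 A2 b2 t).ncard : ℤ)) := by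
  obtain ⟨K1, N1, hN1, h1⟩ := bound_L1 A1 b1 hbdd1
  obtain ⟨K2, N2, hN2, h2⟩ := bound_L2 A2 b2 hbdd2
  obtain ⟨K, hK1, hK2⟩ : ∃ K, K1 ≤ K ∧ K2 ≤ K := ⟨max K1 K2, le_max_left _ _, le_max_right _ _⟩
  let S : Set (Option (Fin n2 × Fin K) → ℕ) :=
    encL2 K A2 b2 \ (restr K Sum.inl '' encFam m K A1 b1)
  have hS : IsSemilinearSet S :=
    (encL2_semilinear K A2 b2).sdiff ((encFam_semilinear m K A1 b1).image _)
  let τ : (Option (Fin n2 × Fin K) → ℕ) →+ ℕ := Pi.evalAddMonoidHom _ none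
  have hcount := hS.count τ (fun t => (digits_finite t).subset fun v hv => ⟨hv.1.1.1, hv.2⟩)
  have hfinal : EQ (fun t => ((latticeL3 m A1 b1 A2 b2 t).ncard : ℚ)) := by
    refine hcount.congr (max N1 N2) fun t ht => ?_
    have ht1 : N1 ≤ t := (le_max_left _ _).trans ht
    have ht2 : N2 ≤ t := (le_max_right _ _).trans ht
    have htpos : 0 < t := by omega
    have hb1 := h1 t ht1 K hK1
    have hb2 := h2 t ht2 K hK2
    have key : ∀ u : Option (Fin n2 × Fin K) → ℕ, DigitsOK u → u none = t →
        (u ∉ restr K Sum.inl '' encFam m K A1 b1 ↔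
        {x3 : Fin n1 → ℤ | Sum.elim (fun j => (num u j : ℤ)) x3 ∈ latticeL1 A1 b1 t}.ncard < m) := by
      intro u hu hut
      rw [mem_encFam_image, ← fiber_ncard K t htpos A1 b1 hb1 u hu hut, ← not_le,
        le_ncard_iff_fin ((digits_finite t).subset ?_)]
      · rfl
      · rintro w ⟨hw, hr⟩
        refine ⟨hw.1, ?_⟩
        rw [← hut, ← hr]; rfl
    congr 1
    symm
    refine Set.ncard_congr (fun u _ j => (num u j : ℤ)) ?_ ?_ ?_
    · rintro u ⟨⟨hu, hn⟩, hut⟩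
      have hut' : u none = t := hut
      refine ⟨?_, (key u hu.1 hut').1 hn⟩
      rw [← hut']; exact hu.2
    · rintro u u' ⟨⟨hu, -⟩, hut⟩ ⟨⟨hu', -⟩, hut'⟩ h
      have e1 : u none = t := hut
      have e2 : u' none = t := hut'
      exact num_inj hu.1 hu'.1 (e1.trans e2.symm) fun j => by exact_mod_cast congrFun h j
    · rintro x ⟨hx, hx3⟩
      obtain ⟨u, hu, hut, hnum⟩ := num_surj (K := K) htpos (fun j => (x j).toNat) (fun j => by
        have h1 := hb2 x hx j
        have h2 := hx.1 j
        zify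
        rw [Int.toNat_of_nonneg h2]
        exact h1)
      have hz : (fun j => (num u j : ℤ)) = x := by
        funext j
        rw [hnum j]
        exact Int.toNat_of_nonneg (hx.1 j)
      refine ⟨u, ⟨⟨⟨hu, ?_⟩, (key u hu hut).2 ?_⟩, hut⟩, hz⟩
      · rw [hz, hut]; exact hx
      · rw [hz]; exact hx3
  obtain ⟨d, hd, R, N, h⟩ := hfinal
  exact ⟨d, hd, R, N, fun t ht => by rw [← h t ht]; simp⟩
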